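/- For every MMCC instance and every feasible LP solution (x, y), there exists a 9-expanded feasible solution whose cost is at most 21 · (∑_{i ∈ I} y i). -/

import Mathlib

/-- A fractional assignment respecting integral capacities can be rounded to an integral one with
the same support. -/
theorem exists_assignment_of_fractional {I J : Type*} [Fintype J] [DecidableEq I]
    (S : Finset I) (U : I → ℕ) (E : I → J → Prop) (z : I → J → ℝ)
    (hz0 : ∀ k j, 0 ≤ z k j) (hE : ∀ k ∈ S, ∀ j, z k j ≠ 0 → E k j)
    (hcap : ∀ k ∈ S, ∑ j, z k j ≤ U k) (hcov : ∀ j, 1 ≤ ∑ k ∈ S, z k j) :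
    ∃ f : J → I, (∀ j, f j ∈ S) ∧ (∀ j, E (f j) j) ∧
      ∀ i, (Finset.univ.filter (fun j => f j = i)).card ≤ U i := by
  classical
  let slots : J → Finset (Σ _ : I, ℕ) := fun j =>
    (S.filter (fun k => E k j)).sigma (fun k => Finset.range (U k))
  have hall : ∀ s : Finset J, s.card ≤ (s.biUnion slots).card := by
    intro s
    let T := S.filter (fun k => ∃ j ∈ s, E k j)
    have hsub : T.sigma (fun k => Finset.range (U k)) ⊆ s.biUnion slots := by
      rintro ⟨k, n⟩ hk
      simp only [T, slots, Finset.mem_sigma, Finset.mem_filter, Finset.mem_biUnion] at hk ⊢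
      obtain ⟨⟨hkS, j, hj, hjE⟩, hn⟩ := hk
      exact ⟨j, hj, ⟨hkS, hjE⟩, hn⟩
    refine le_trans ?_ (Finset.card_le_card hsub)
    rw [Finset.card_sigma]
    simp only [Finset.card_range]
    have hreal : (s.card : ℝ) ≤ ∑ k ∈ T, (U k : ℝ) := by
      calc (s.card : ℝ) = ∑ j ∈ s, (1 : ℝ) := by simp
        _ ≤ ∑ j ∈ s, ∑ k ∈ S, z k j := Finset.sum_le_sum fun j _ => hcov j
        _ = ∑ j ∈ s, ∑ k ∈ T, z k j := by
            refine Finset.sum_congr rfl fun j hj => ?_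
            symm
            refine Finset.sum_subset (Finset.filter_subset _ _) fun k hk hkT => ?_
            by_contra hne
            exact hkT (Finset.mem_filter.2 ⟨hk, j, hj, hE k hk j hne⟩)
        _ = ∑ k ∈ T, ∑ j ∈ s, z k j := Finset.sum_comm
        _ ≤ ∑ k ∈ T, ∑ j, z k j := Finset.sum_le_sum fun k _ =>
            Finset.sum_le_sum_of_subset_of_nonneg (Finset.subset_univ _) fun j _ _ => hz0 k j
        _ ≤ ∑ k ∈ T, (U k : ℝ) := Finset.sum_le_sum fun k hk =>
            hcap k (Finset.mem_filter.1 hk).1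
    exact_mod_cast hreal
  obtain ⟨g, hinj, hg⟩ := (Finset.all_card_le_biUnion_card_iff_exists_injective slots).1 hall
  simp only [slots, Finset.mem_sigma, Finset.mem_filter, Finset.mem_range] at hg
  refine ⟨fun j => (g j).1, fun j => (hg j).1.1, fun j => (hg j).1.2, fun i => ?_⟩
  rw [← Finset.card_range (U i)]
  refine Finset.card_le_card_of_injOn (fun j => (g j).2) (fun j hj => ?_) fun j hj j' hj' h => ?_
  · have hji : (g j).1 = i := by simpa using hj
    simpa [← hji] using (hg j).2
  · have hji : (g j).1 = i := by simpa using hj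
    have hji' : (g j').1 = i := by simpa using hj'
    exact hinj (Sigma.ext (hji.trans hji'.symm) (heq_of_eq h))

/-- A finite family of weights in `[0, 1]` of total weight more than `1/3` has a subfamily of total
weight in `(1/3, 1]`. -/
theorem exists_subset_sum_mem_Ioc {I : Type*} [DecidableEq I] (y : I → ℝ) (hy1 : ∀ i, y i ≤ 1)
    (G : Finset I) (hG : 1 / 3 < ∑ i ∈ G, y i) :
    ∃ G' ⊆ G, 1 / 3 < ∑ i ∈ G', y i ∧ ∑ i ∈ G', y i ≤ 1 := by
  induction G using Finset.induction_on with
  | empty => norm_num at hG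
  | insert a s ha ih =>
    by_cases hs : 1 / 3 < ∑ i ∈ s, y i
    · obtain ⟨G', hsub, h⟩ := ih hs
      exact ⟨G', hsub.trans (Finset.subset_insert a s), h⟩
    · by_cases hya : 1 / 3 < y a
      · exact ⟨{a}, by simp, by simpa using hya, by simpa using hy1 a⟩
      · refine ⟨insert a s, subset_rfl, hG, ?_⟩
        rw [Finset.sum_insert ha]
        linarith

/-- Balls can be merged greedily into groups of total weight in `(1/3, 1]`, each group having a
common neighbour and a dominating member, until every neighbour sees leftover weight at most
`1/3`. -/
theorem exists_merging {I K : Type*} [DecidableEq I] (D : I → I → Prop)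
    (hD : ∀ G : Finset I, G.Nonempty → ∃ t ∈ G, ∀ i ∈ G, D i t)
    (N : I → K → Prop) [∀ k, DecidablePred fun i => N i k] (y : I → ℝ)
    (hy1 : ∀ i, y i ≤ 1) (L : Finset I) :
    ∃ A ⊆ L, ∃ t : I → I,
      (∀ i ∈ A, t i ∈ A ∧ D i (t i) ∧ ∃ k, N i k ∧ N (t i) k) ∧
      (∀ k, ∑ i ∈ A with t i = k, y i ≤ 1) ∧
      ((A.image t).card : ℝ) ≤ 3 * ∑ i ∈ A, y i ∧
      ∀ k, ∑ i ∈ L \ A with N i k, y i ≤ 1 / 3 := by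
  induction L using Finset.strongInduction with
  | H L ih =>
  by_cases hL : ∀ k, ∑ i ∈ L with N i k, y i ≤ 1 / 3
  · exact ⟨∅, by simp, id, by simp, by simp, by simp, by simpa using hL⟩
  push Not at hL
  obtain ⟨k₀, hk₀⟩ := hL
  obtain ⟨G, hGsub, hG, hG1⟩ := exists_subset_sum_mem_Ioc y hy1 _ hk₀
  have hGne : G.Nonempty := by
    rw [Finset.nonempty_iff_ne_empty]
    rintro rfl
    norm_num at hG
  have hGL : G ⊆ L := hGsub.trans (Finset.filter_subset _ _)
  have hGN : ∀ i ∈ G, N i k₀ := fun i hi => (Finset.mem_filter.1 (hGsub hi)).2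
  obtain ⟨m, hm, hmD⟩ := hD G hGne
  obtain ⟨A, hAL, t, hA, hfib, hcard, hleft⟩ := ih (L \ G) (Finset.sdiff_ssubset hGL hGne)
  have hdisj : Disjoint A G := Finset.disjoint_of_subset_left hAL Finset.sdiff_disjoint
  have hAG : ∀ i ∈ A, i ∉ G := fun i hi => Finset.disjoint_left.1 hdisj hi
  have ht_mem : ∀ i ∈ G, (if i ∈ G then m else t i) = m := fun i hi => if_pos hi
  have ht_not : ∀ i ∈ A, (if i ∈ G then m else t i) = t i := fun i hi => if_neg (hAG i hi)
  refine ⟨A ∪ G, Finset.union_subset (hAL.trans Finset.sdiff_subset) hGL,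
    fun i => if i ∈ G then m else t i, ?_, ?_, ?_, ?_⟩
  · intro i hi
    rcases Finset.mem_union.1 hi with hi | hi
    · simp only [ht_not i hi]
      exact ⟨Finset.mem_union_left _ (hA i hi).1, (hA i hi).2⟩
    · simp only [ht_mem i hi]
      exact ⟨Finset.mem_union_right _ hm, hmD i hi, k₀, hGN i hi, hGN m hm⟩
  · intro k
    by_cases hk : k = m
    · subst hk
      have : (A ∪ G).filter (fun i => (if i ∈ G then k else t i) = k) = G := by
        ext i
        simp only [Finset.mem_filter, Finset.mem_union]
        refine ⟨fun ⟨hi, h⟩ => ?_, fun hi => ⟨Or.inr hi, if_pos hi⟩⟩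
        by_contra hiG
        have hiA : i ∈ A := hi.resolve_right hiG
        rw [if_neg hiG] at h
        exact hAG _ (hA i hiA).1 (h ▸ hm)
      rw [this]
      exact hG1
    · have : (A ∪ G).filter (fun i => (if i ∈ G then m else t i) = k)
          = A.filter (fun i => t i = k) := by
        ext i
        simp only [Finset.mem_filter, Finset.mem_union]
        constructor
        · rintro ⟨hi, h⟩
          by_cases hiG : i ∈ G
          · rw [if_pos hiG] at h
            exact absurd h.symm hk
          · rw [if_neg hiG] at h
            exact ⟨hi.resolve_right hiG, h⟩
        · rintro ⟨hi, h⟩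
          exact ⟨Or.inl hi, by rw [if_neg (hAG i hi), h]⟩
      rw [this]
      exact hfib k
  · have himg : (A ∪ G).image (fun i => if i ∈ G then m else t i) ⊆ insert m (A.image t) := by
      intro k hk
      obtain ⟨i, hi, rfl⟩ := Finset.mem_image.1 hk
      by_cases hiG : i ∈ G
      · simp [hiG]
      · have hiA : i ∈ A := (Finset.mem_union.1 hi).resolve_right hiG
        simp only [hiG, if_false]
        exact Finset.mem_insert_of_mem (Finset.mem_image_of_mem t hiA)
    have h1 : (((A ∪ G).image (fun i => if i ∈ G then m else t i)).card : ℝ)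
        ≤ (A.image t).card + 1 := by
      exact_mod_cast (Finset.card_le_card himg).trans (Finset.card_insert_le _ _)
    rw [Finset.sum_union hdisj]
    linarith
  · intro k
    have : L \ (A ∪ G) = (L \ G) \ A := by
      ext i
      simp only [Finset.mem_sdiff, Finset.mem_union]
      tauto
    rw [this]
    exact hleft k

/-- Balls carrying a key can be partitioned into groups of total weight at most `1`, each with a
common key and a dominating member, using few groups. -/
theorem exists_merging_of_key {I K : Type*} [DecidableEq I] [DecidableEq K] (D : I → I → Prop)
    (hD : ∀ G : Finset I, G.Nonempty → ∃ t ∈ G, ∀ i ∈ G, D i t)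
    (key : I → K) (y : I → ℝ) (hy0 : ∀ i, 0 ≤ y i) (hy1 : ∀ i, y i ≤ 1) (L : Finset I) :
    ∃ t : I → I,
      (∀ i ∈ L, t i ∈ L ∧ D i (t i) ∧ key (t i) = key i) ∧
      (∀ k, ∑ i ∈ L with t i = k, y i ≤ 1) ∧
      ((L.image t).card : ℝ) ≤ 3 * ∑ i ∈ L, y i + (L.image key).card := by
  rcases L.eq_empty_or_nonempty with rfl | ⟨i₀, -⟩
  · exact ⟨id, by simp, by simp, by simp⟩
  obtain ⟨A, hAL, t, hA, hfib, hcard, hleft⟩ :=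
    exists_merging D hD (fun i k => key i = k) y hy1 L
  have hrep : ∀ k : K, ∃ m : I, ∀ i ∈ L \ A, key i = k → m ∈ L \ A ∧ key m = k ∧ D i m := by
    intro k
    by_cases hne : ((L \ A).filter fun i => key i = k).Nonempty
    · obtain ⟨m, hm, hmD⟩ := hD _ hne
      have hm' := Finset.mem_filter.1 hm
      exact ⟨m, fun i hi hik => ⟨hm'.1, hm'.2, hmD i (Finset.mem_filter.2 ⟨hi, hik⟩)⟩⟩
    · exact ⟨i₀, fun i hi hik => absurd ⟨i, Finset.mem_filter.2 ⟨hi, hik⟩⟩ hne⟩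
  choose m hm using hrep
  refine ⟨fun i => if i ∈ A then t i else m (key i), ?_, ?_, ?_⟩
  · intro i hi
    by_cases hiA : i ∈ A
    · simp only [hiA, if_true]
      obtain ⟨h1, h2, k, h3, h4⟩ := hA i hiA
      exact ⟨hAL h1, h2, h4.trans h3.symm⟩
    · simp only [hiA, if_false]
      obtain ⟨h1, h2, h3⟩ := hm (key i) i (Finset.mem_sdiff.2 ⟨hi, hiA⟩) rfl
      exact ⟨(Finset.mem_sdiff.1 h1).1, h3, h2⟩
  · intro k
    by_cases hk : k ∈ A
    · refine le_trans (Finset.sum_le_sum_of_subset_of_nonneg ?_ fun i _ _ => hy0 i) (hfib k)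
      intro i hi
      obtain ⟨hiL, h⟩ := Finset.mem_filter.1 hi
      beta_reduce at h
      by_cases hiA : i ∈ A
      · rw [if_pos hiA] at h
        exact Finset.mem_filter.2 ⟨hiA, h⟩
      · rw [if_neg hiA] at h
        have := (hm (key i) i (Finset.mem_sdiff.2 ⟨hiL, hiA⟩) rfl).1
        exact absurd hk (h ▸ (Finset.mem_sdiff.1 this).2)
    · refine le_trans (Finset.sum_le_sum_of_subset_of_nonneg ?_ fun i _ _ => hy0 i)
        ((hleft (key k)).trans (by norm_num))
      intro i hi
      obtain ⟨hiL, h⟩ := Finset.mem_filter.1 hi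
      beta_reduce at h
      by_cases hiA : i ∈ A
      · rw [if_pos hiA] at h
        exact absurd (h ▸ (hA i hiA).1) hk
      · rw [if_neg hiA] at h
        have hiLA := Finset.mem_sdiff.2 ⟨hiL, hiA⟩
        refine Finset.mem_filter.2 ⟨hiLA, ?_⟩
        rw [← h]
        exact (hm (key i) i hiLA rfl).2.1.symm
  · have himg : L.image (fun i => if i ∈ A then t i else m (key i))
        ⊆ A.image t ∪ (L.image key).image m := by
      intro k hk
      obtain ⟨i, hi, rfl⟩ := Finset.mem_image.1 hk
      by_cases hiA : i ∈ A
      · simp only [hiA, if_true]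
        exact Finset.mem_union_left _ (Finset.mem_image_of_mem t hiA)
      · simp only [hiA, if_false]
        exact Finset.mem_union_right _
          (Finset.mem_image_of_mem m (Finset.mem_image_of_mem key hi))
    have h1 : ((L.image (fun i => if i ∈ A then t i else m (key i))).card : ℝ)
        ≤ (A.image t).card + (L.image key).card := by
      exact_mod_cast (Finset.card_le_card himg).trans ((Finset.card_union_le _ _).trans
        (Nat.add_le_add_left Finset.card_image_le _))
    have h2 : ∑ i ∈ A, y i ≤ ∑ i ∈ L, y i :=
      Finset.sum_le_sum_of_subset_of_nonneg hAL fun i _ _ => hy0 i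
    linarith

/-- Rerouting of light balls. Light ball `ℓ` carries the flow `y ℓ * u ℓ j` to `j`, and the heavy
ball `h` carries `w h j`, everything being scaled at `j` by the fraction `ρ j` not yet served by
opened light balls. The light balls are processed in order of decreasing `∑ j, ρ j * u ℓ j`; each
of them is either absorbed by an adjacent heavy ball with enough spare capacity or opened. The
potential `β h` is a lower bound for the spare capacity of `h` measured in units of the current
light ball. -/
theorem exists_light_rerouting {I J : Type*} [Fintype J] [DecidableEq I] (H L : Finset I)
    (hHL : Disjoint H L) (U : I → ℝ) (y : I → ℝ) (u w₀ : I → J → ℝ) (E : I → J → Prop)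
    (hy0 : ∀ i, 0 ≤ y i) (hu0 : ∀ i j, 0 ≤ u i j) (hu1 : ∀ i j, u i j ≤ 1)
    (hlight : ∀ l ∈ L, ∀ j, u l j ≠ 0 → y l ≤ 1 / 3) (hw₀ : ∀ h j, 0 ≤ w₀ h j)
    (hW : ∀ j, 2 / 3 ≤ ∑ h ∈ H, w₀ h j) (hcapL : ∀ l ∈ L, ∑ j, u l j ≤ U l)
    (hE : ∀ h ∈ H, ∀ l ∈ L, ∀ j, w₀ h j ≠ 0 → u l j ≠ 0 → ∀ j', u l j' ≠ 0 → E h j')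
    (Q : Finset I) (hQL : Q ⊆ L) (ρ : J → ℝ) (w : I → J → ℝ) (β : I → ℝ)
    (hρ0 : ∀ j, 0 ≤ ρ j) (hρ1 : ∀ j, ρ j ≤ 1) (hw : ∀ h j, w₀ h j ≤ w h j)
    (hsum : ∀ j, ∑ h ∈ H, w h j + ∑ l ∈ Q, y l * u l j ≤ 1)
    (hload : ∀ h ∈ H, ∑ j, ρ j * w h j ≤ U h) (hβ : ∀ h ∈ H, β h ≤ 4 / 3)
    (hβV : ∀ h ∈ H, ∀ l ∈ Q, β h * ∑ j, ρ j * u l j ≤ U h - ∑ j, ρ j * w h j)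
    (hwE : ∀ h ∈ H, ∀ j, w h j ≠ 0 → E h j) :
    ∃ O ⊆ Q, ∃ z : I → J → ℝ, (∀ k j, 0 ≤ z k j) ∧
      (∀ h ∈ H, ∑ j, z h j ≤ U h) ∧ (∀ l ∈ O, ∑ j, z l j ≤ U l) ∧
      (∀ h ∈ H, ∀ j, z h j ≠ 0 → E h j) ∧ (∀ l ∈ O, ∀ j, z l j ≠ 0 → u l j ≠ 0) ∧
      (∀ j, ρ j * (∑ h ∈ H, w h j + ∑ l ∈ Q, y l * u l j)
        ≤ ∑ h ∈ H, z h j + ∑ l ∈ O, z l j) ∧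
      ∑ h ∈ H, β h + 4 / 9 * (O.card : ℝ) ≤ 4 / 3 * (H.card : ℝ) + ∑ l ∈ Q, y l := by
  induction hn : Q.card generalizing Q ρ w β with
  | zero =>
    obtain rfl := Finset.card_eq_zero.1 hn
    refine ⟨∅, subset_rfl, fun k j => ρ j * w k j,
      fun k j => mul_nonneg (hρ0 j) ((hw₀ k j).trans (hw k j)), hload, by simp,
      fun h hh j hne => hwE h hh j (right_ne_zero_of_mul hne), by simp, fun j => ?_, ?_⟩
    · simp [Finset.mul_sum]
    · have := Finset.sum_le_sum hβ
      simp only [Finset.sum_const, nsmul_eq_mul] at this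
      simp
      linarith
  | succ n ih =>
    have hQne : Q.Nonempty := Finset.card_pos.1 (by omega)
    obtain ⟨l, hlQ, hlmax⟩ := Finset.exists_max_image Q (fun l => ∑ j, ρ j * u l j) hQne
    have hlL := hQL hlQ
    have hcard : (Q.erase l).card = n := by rw [Finset.card_erase_of_mem hlQ]; omega
    have hQ'L : Q.erase l ⊆ L := (Finset.erase_subset _ _).trans hQL
    have hsplit : ∀ g : I → ℝ, ∑ i ∈ Q, g i = g l + ∑ i ∈ Q.erase l, g i := fun g =>
      (Finset.add_sum_erase Q g hlQ).symm
    set V := ∑ j, ρ j * u l j with hV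
    have hV0 : 0 ≤ V := Finset.sum_nonneg fun j _ => mul_nonneg (hρ0 j) (hu0 l j)
    have hyu : ∀ i j, 0 ≤ y i * u i j := fun i j => mul_nonneg (hy0 i) (hu0 i j)
    rcases hV0.eq_or_lt with hVz | hVpos
    · -- the light ball carries no flow any more
      have hz : ∀ j, ρ j * u l j = 0 := fun j =>
        (Finset.sum_eq_zero_iff_of_nonneg fun j _ => mul_nonneg (hρ0 j) (hu0 l j)).1
          (hV ▸ hVz.symm) j (Finset.mem_univ j)
      obtain ⟨O, hO, z, h1, h2, h3, h4, h5, h6, h7⟩ := ih (Q.erase l) hQ'L ρ w β hρ0 hρ1 hw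
        (fun j => by have := hsum j; rw [hsplit] at this; linarith [hyu l j])
        hload hβ (fun h hh i hi => hβV h hh i (Finset.mem_of_mem_erase hi)) hwE hcard
      refine ⟨O, hO.trans (Finset.erase_subset _ _), z, h1, h2, h3, h4, h5, fun j => ?_, ?_⟩
      · rw [hsplit]
        have : ρ j * (y l * u l j) = 0 := by rw [mul_left_comm, hz j, mul_zero]
        linarith [h6 j, mul_add (ρ j) (y l * u l j) (∑ i ∈ Q.erase l, y i * u i j),
          mul_add (ρ j) (∑ h ∈ H, w h j) (∑ i ∈ Q.erase l, y i * u i j),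
          mul_add (ρ j) (∑ h ∈ H, w h j) (y l * u l j + ∑ i ∈ Q.erase l, y i * u i j)]
      · rw [hsplit]
        linarith [hy0 l]
    · have hyl : y l ≤ 1 / 3 := by
        obtain ⟨j, -, hj⟩ := Finset.exists_ne_zero_of_sum_ne_zero (hV ▸ hVpos.ne')
        exact hlight l hlL j (right_ne_zero_of_mul hj)
      by_cases habs : ∃ h ∈ H, (∃ j, w₀ h j ≠ 0 ∧ u l j ≠ 0) ∧
          y l * V ≤ U h - ∑ j, ρ j * w h j
      · -- absorb the light ball
        obtain ⟨g, hg, ⟨j₀, hj₀w, hj₀u⟩, hgcap⟩ := habs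
        let w' : I → J → ℝ := fun h j => w h j + if h = g then y l * u l j else 0
        have hw'sum : ∀ j, ∑ h ∈ H, w' h j = ∑ h ∈ H, w h j + y l * u l j := by
          intro j
          simp [w', Finset.sum_add_distrib, hg]
        have hw'load : ∀ h, ∑ j, ρ j * w' h j
            = ∑ j, ρ j * w h j + if h = g then y l * V else 0 := by
          intro h
          by_cases hhg : h = g
          · simp only [w', hhg, if_true, hV, Finset.mul_sum, mul_add, Finset.sum_add_distrib]
            congr 1
            exact Finset.sum_congr rfl fun j _ => by ring
          · simp [w', hhg]
        obtain ⟨O, hO, z, h1, h2, h3, h4, h5, h6, h7⟩ := ih (Q.erase l) hQ'L ρ w'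
          (fun h => β h - if h = g then y l else 0) hρ0 hρ1
          (fun h j => by
            refine (hw h j).trans (le_add_of_nonneg_right ?_)
            split_ifs
            exacts [hyu l j, le_rfl])
          (fun j => by have := hsum j; rw [hsplit] at this; rw [hw'sum]; linarith)
          (fun h hh => by
            rw [hw'load]
            split_ifs with hhg
            · subst hhg; linarith
            · linarith [hload h hh])
          (fun h hh => by
            have := hβ h hh
            split_ifs <;> linarith [hy0 l])
          (fun h hh i hi => by
            have hiQ := Finset.mem_of_mem_erase hi
            have hVi : ∑ j, ρ j * u i j ≤ V := hlmax i hiQ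
            have hVi0 : 0 ≤ ∑ j, ρ j * u i j :=
              Finset.sum_nonneg fun j _ => mul_nonneg (hρ0 j) (hu0 i j)
            rw [hw'load]
            by_cases hhg : h = g
            · subst hhg
              simp only [if_true]
              have := hβV h hh l hlQ
              rcases le_total 0 (β h - y l) with hs | hs
              · nlinarith [mul_le_mul_of_nonneg_left hVi hs]
              · nlinarith [mul_nonneg (neg_nonneg.2 hs) hVi0]
            · simpa [hhg] using hβV h hh i hiQ)
          (fun h hh j hne => by
            by_cases hwz : w h j = 0
            · by_cases hhg : h = g
              · subst hhg
                simp only [w', hwz, if_true, zero_add] at hne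
                exact hE h hh l hlL j₀ hj₀w hj₀u j (right_ne_zero_of_mul hne)
              · simp [w', hwz, hhg] at hne
            · exact hwE h hh j hwz) hcard
        refine ⟨O, hO.trans (Finset.erase_subset _ _), z, h1, h2, h3, h4, h5, fun j => ?_, ?_⟩
        · have := h6 j
          rw [hw'sum] at this
          rwa [hsplit, ← add_assoc]
        · rw [hsplit]
          simp only [Finset.sum_sub_distrib, Finset.sum_ite_eq', hg, if_true] at h7
          linarith
      · -- open the light ball
        push Not at habs
        let ρ' : J → ℝ := fun j => ρ j * (1 - u l j * (1 - y l))
        let a : I → ℝ := fun h => ∑ j, ρ j * w₀ h j * u l j * (1 - y l)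
        have hfac0 : ∀ j, 0 ≤ u l j * (1 - y l) := fun j =>
          mul_nonneg (hu0 l j) (by linarith)
        have hfac1 : ∀ j, u l j * (1 - y l) ≤ 1 := fun j =>
          mul_le_one₀ (hu1 l j) (by linarith) (by linarith [hy0 l])
        have hρ'0 : ∀ j, 0 ≤ ρ' j := fun j => mul_nonneg (hρ0 j) (by linarith [hfac1 j])
        have hρ'le : ∀ j, ρ' j ≤ ρ j := fun j =>
          mul_le_of_le_one_right (hρ0 j) (by linarith [hfac0 j])
        have ha0 : ∀ h, 0 ≤ a h := fun h => Finset.sum_nonneg fun j _ => by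
          have := mul_nonneg (mul_nonneg (hρ0 j) (hw₀ h j)) (hfac0 j)
          linarith
        have hw₀1 : ∀ h ∈ H, ∀ j, w₀ h j ≤ 1 := fun h hh j => by
          have h1 : w h j ≤ ∑ h ∈ H, w h j :=
            Finset.single_le_sum (f := fun h => w h j)
              (fun h _ => (hw₀ h j).trans (hw h j)) hh
          have h2 : 0 ≤ ∑ l ∈ Q, y l * u l j := Finset.sum_nonneg fun i _ => hyu i j
          linarith [hw h j, hsum j]
        have haV : ∀ h ∈ H, a h ≤ V := fun h hh => Finset.sum_le_sum fun j _ => by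
          have h1 : w₀ h j * (1 - y l) ≤ 1 :=
            mul_le_one₀ (hw₀1 h hh j) (by linarith) (by linarith [hy0 l])
          nlinarith [mul_le_mul_of_nonneg_left h1 (mul_nonneg (hρ0 j) (hu0 l j))]
        have hasum : 4 / 9 * V ≤ ∑ h ∈ H, a h := by
          rw [Finset.sum_comm, hV, Finset.mul_sum]
          refine Finset.sum_le_sum fun j _ => ?_
          have h1 : ∑ h ∈ H, ρ j * w₀ h j * u l j * (1 - y l)
              = (ρ j * u l j) * ((∑ h ∈ H, w₀ h j) * (1 - y l)) := by
            rw [Finset.sum_mul, Finset.mul_sum]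
            exact Finset.sum_congr rfl fun h _ => by ring
          have h2 : (4 : ℝ) / 9 ≤ (∑ h ∈ H, w₀ h j) * (1 - y l) := by
            nlinarith [hW j]
          rw [h1, mul_comm]
          exact mul_le_mul_of_nonneg_left h2 (mul_nonneg (hρ0 j) (hu0 l j))
        have hfree : ∀ h, ∑ j, ρ' j * w h j + a h ≤ ∑ j, ρ j * w h j := by
          intro h
          rw [← Finset.sum_add_distrib]
          refine Finset.sum_le_sum fun j _ => ?_
          simp only [ρ']
          nlinarith [mul_le_mul_of_nonneg_left (hw h j) (mul_nonneg (hρ0 j) (hfac0 j))]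
        have hazero : ∀ h ∈ H, a h ≠ 0 → U h - ∑ j, ρ j * w h j < y l * V := by
          intro h hh hne
          obtain ⟨j, -, hj⟩ := Finset.exists_ne_zero_of_sum_ne_zero hne
          refine habs h hh ⟨j, ?_, ?_⟩
          · rintro h0; simp [h0] at hj
          · rintro h0; simp [h0] at hj
        obtain ⟨O, hO, z, h1, h2, h3, h4, h5, h6, h7⟩ := ih (Q.erase l) hQ'L ρ' w
          (fun h => β h + a h / V) hρ'0 (fun j => (hρ'le j).trans (hρ1 j)) hw
          (fun j => by have := hsum j; rw [hsplit] at this; linarith [hyu l j])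
          (fun h hh => by linarith [hfree h, ha0 h, hload h hh])
          (fun h hh => by
            by_cases haz : a h = 0
            · simpa [haz] using hβ h hh
            · have hlt := (hβV h hh l hlQ).trans_lt (hazero h hh haz)
              have hβy : β h < y l := lt_of_mul_lt_mul_right hlt hV0
              have : a h / V ≤ 1 := (div_le_one hVpos).2 (haV h hh)
              linarith)
          (fun h hh i hi => by
            have hiQ := Finset.mem_of_mem_erase hi
            have hVi' : ∑ j, ρ' j * u i j ≤ V :=
              (Finset.sum_le_sum fun j _ =>
                mul_le_mul_of_nonneg_right (hρ'le j) (hu0 i j)).trans (hlmax i hiQ)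
            have hVi0 : 0 ≤ ∑ j, ρ' j * u i j :=
              Finset.sum_nonneg fun j _ => mul_nonneg (hρ'0 j) (hu0 i j)
            have hcur := hβV h hh l hlQ
            have hdiv : a h / V * V = a h := div_mul_cancel₀ _ hVpos.ne'
            rcases le_total 0 (β h + a h / V) with hs | hs
            · nlinarith [mul_le_mul_of_nonneg_left hVi' hs, hfree h]
            · nlinarith [mul_nonneg (neg_nonneg.2 hs) hVi0, hfree h, ha0 h, hload h hh])
          hwE hcard
        have hlO : l ∉ O := fun h => Finset.notMem_erase l Q (hO h)
        have hlH : ∀ h ∈ H, h ≠ l := fun h hh hEq =>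
          Finset.disjoint_left.1 hHL hh (hEq ▸ hlL)
        have hOl : ∀ i ∈ O, i ≠ l := fun i hi hEq => hlO (hEq ▸ hi)
        refine ⟨insert l O, Finset.insert_subset hlQ (hO.trans (Finset.erase_subset _ _)),
          Function.update z l (fun j => ρ j * u l j), ?_, ?_, ?_, ?_, ?_, ?_, ?_⟩
        · intro k j
          by_cases hk : k = l
          · subst hk
            simpa using mul_nonneg (hρ0 j) (hu0 k j)
          · simpa [hk] using h1 k j
        · intro h hh
          simpa [hlH h hh] using h2 h hh
        · intro i hi
          rcases Finset.mem_insert.1 hi with rfl | hi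
          · simp only [Function.update_self]
            exact (Finset.sum_le_sum fun j _ =>
              mul_le_of_le_one_left (hu0 i j) (hρ1 j)).trans (hcapL i hlL)
          · simpa [hOl i hi] using h3 i hi
        · intro h hh j hne
          rw [Function.update_of_ne (hlH h hh)] at hne
          exact h4 h hh j hne
        · intro i hi j hne
          rcases Finset.mem_insert.1 hi with rfl | hi
          · rw [Function.update_self] at hne
            exact right_ne_zero_of_mul hne
          · rw [Function.update_of_ne (hOl i hi)] at hne
            exact h5 i hi j hne
        · intro j
          have e1 : ∑ h ∈ H, Function.update z l (fun j => ρ j * u l j) h j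
              = ∑ h ∈ H, z h j :=
            Finset.sum_congr rfl fun h hh => by rw [Function.update_of_ne (hlH h hh)]
          have e2 : ∑ i ∈ O, Function.update z l (fun j => ρ j * u l j) i j
              = ∑ i ∈ O, z i j :=
            Finset.sum_congr rfl fun i hi => by rw [Function.update_of_ne (hOl i hi)]
          rw [Finset.sum_insert hlO, e1, e2, Function.update_self, hsplit]
          have hs := hsum j
          rw [hsplit] at hs
          have h6j := h6 j
          set R := ∑ h ∈ H, w h j + ∑ i ∈ Q.erase l, y i * u i j with hR
          have hR1 : R ≤ 1 := by linarith [hyu l j]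
          have key : 0 ≤ ρ j * (u l j * (1 - y l)) * (1 - R) :=
            mul_nonneg (mul_nonneg (hρ0 j) (hfac0 j)) (by linarith)
          have e3 : ∑ h ∈ H, w h j + (y l * u l j + ∑ i ∈ Q.erase l, y i * u i j)
              = R + y l * u l j := by rw [hR]; ring
          rw [e3]
          have h6j' : ρ j * (1 - u l j * (1 - y l)) * R
              ≤ ∑ h ∈ H, z h j + ∑ i ∈ O, z i j := h6j
          nlinarith
        · rw [Finset.card_insert_of_notMem hlO, hsplit]
          simp only [Finset.sum_add_distrib, ← Finset.sum_div] at h7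
          have : 4 / 9 ≤ (∑ h ∈ H, a h) / V := (le_div_iff₀ hVpos).2 hasum
          push_cast
          linarith [hy0 l]

/-- The flow of a group of balls of total weight at most `1` fits into any ball whose capacity
dominates the capacities of the group. -/
theorem sum_merged_flow_le {I J : Type*} [Fintype J] (U : I → ℕ) (x : I → J → ℝ) (y : I → ℝ)
    (hy0 : ∀ i, 0 ≤ y i) (hcap : ∀ i, ∑ j, x i j ≤ y i * U i) (G : Finset I) (k : I)
    (hG : ∑ i ∈ G, y i ≤ 1) (hU : ∀ i ∈ G, U i ≤ U k) :
    ∑ j, ∑ i ∈ G, x i j ≤ U k := by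
  rw [Finset.sum_comm]
  calc ∑ i ∈ G, ∑ j, x i j ≤ ∑ i ∈ G, y i * U k := Finset.sum_le_sum fun i hi =>
        (hcap i).trans (mul_le_mul_of_nonneg_left (by exact_mod_cast hU i hi) (hy0 i))
    _ = (∑ i ∈ G, y i) * U k := by rw [Finset.sum_mul]
    _ ≤ U k := mul_le_of_le_one_left (Nat.cast_nonneg _) hG

/-- Monotone capacities: every nonempty set of balls has a member of maximal radius and maximal
capacity. -/
theorem exists_dominating_ball {I : Type*} (r : I → ℝ) (U : I → ℕ)
    (hmono : ∀ i i', r i' < r i → U i' ≤ U i) (G : Finset I) (hG : G.Nonempty) :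
    ∃ t ∈ G, ∀ i ∈ G, r i ≤ r t ∧ U i ≤ U t := by
  obtain ⟨t, ht, hmax⟩ := Finset.exists_max_image G (fun i => toLex (r i, U i)) hG
  refine ⟨t, ht, fun i hi => ?_⟩
  rcases Prod.Lex.toLex_le_toLex.1 (hmax i hi) with h | h
  · exact ⟨h.le, hmono t i h⟩
  · exact ⟨h.1.le, h.2⟩

/-- For every MMCC instance and every feasible LP solution `(x, y)`, there exists
a 9-expanded feasible solution whose cost is at most `21 * ∑ i, y i`. -/
theorem mmcc_lp_rounding
    (X : Type*) [MetricSpace X]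
    (J I : Type*) [Fintype J] [Fintype I] [DecidableEq I]
    (p : J → X) (c : I → X) (r : I → ℝ) (U : I → ℕ)
    (hr : ∀ i, 0 < r i) (hU : ∀ i, 1 ≤ U i)
    (hmono : ∀ i i', r i' < r i → U i' ≤ U i)
    (x : I → J → ℝ) (y : I → ℝ)
    (hx0 : ∀ i j, 0 ≤ x i j) (hxy : ∀ i j, x i j ≤ y i) (hy1 : ∀ i, y i ≤ 1)
    (hcap : ∀ i, ∑ j, x i j ≤ y i * U i)
    (hflow : ∀ j, ∑ i, x i j = 1)
    (hcover : ∀ i j, r i < dist (c i) (p j) → x i j = 0) :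
    ∃ (S : Finset I) (f : J → I),
      (S.card : ℝ) ≤ 21 * ∑ i, y i ∧ (∀ j, f j ∈ S) ∧
      (∀ j, dist (c (f j)) (p j) ≤ 9 * r (f j)) ∧
      (∀ i, (Finset.univ.filter (fun j => f j = i)).card ≤ U i) := by
  classical
  have hy0 : ∀ i, 0 ≤ y i := fun i =>
    nonneg_of_mul_nonneg_left ((Finset.sum_nonneg fun j _ => hx0 i j).trans (hcap i))
      (Nat.cast_pos.2 (hU i))
  have hball : ∀ i j, x i j ≠ 0 → dist (c i) (p j) ≤ r i := fun i j hne =>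
    not_lt.1 fun hlt => hne (hcover i j hlt)
  have hD := exists_dominating_ball r U hmono
  -- heavy balls
  obtain ⟨A, -, t, hA, hfib, hcardH, hleft⟩ :=
    exists_merging _ hD (fun i j => x i j ≠ 0) y hy1 Finset.univ
  set H := A.image t
  let w₀ : I → J → ℝ := fun k j => ∑ i ∈ A with t i = k, x i j
  have hw₀ : ∀ k j, 0 ≤ w₀ k j := fun k j => Finset.sum_nonneg fun i _ => hx0 i j
  have hw₀sum : ∀ j, ∑ h ∈ H, w₀ h j = ∑ i ∈ A, x i j := fun j =>
    Finset.sum_fiberwise_of_maps_to (fun i hi => Finset.mem_image_of_mem t hi) _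
  have hHA : H ⊆ A := Finset.image_subset_iff.2 fun i hi => (hA i hi).1
  have hw₀dist : ∀ h j, w₀ h j ≠ 0 → dist (c h) (p j) ≤ 3 * r h := by
    intro h j hne
    obtain ⟨i, hi, hij⟩ := Finset.exists_ne_zero_of_sum_ne_zero hne
    obtain ⟨hiA, rfl⟩ := Finset.mem_filter.1 hi
    obtain ⟨-, ⟨hri, -⟩, j', h1, h2⟩ := hA i hiA
    have t1 := dist_triangle4 (c (t i)) (p j') (c i) (p j)
    rw [dist_comm (p j') (c i)] at t1
    linarith [hball _ _ h1, hball _ _ h2, hball _ _ hij]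
  have hw₀load : ∀ h ∈ H, ∑ j, w₀ h j ≤ U h := fun h _ =>
    sum_merged_flow_le U x y hy0 hcap _ h (hfib h) fun i hi => by
      obtain ⟨hiA, rfl⟩ := Finset.mem_filter.1 hi
      exact (hA i hiA).2.1.2
  have hrest : ∀ j, ∑ i ∈ Finset.univ \ A, x i j ≤ 1 / 3 := by
    intro j
    refine le_trans ?_ (hleft j)
    rw [← Finset.sum_filter_ne_zero]
    exact Finset.sum_le_sum fun i _ => hxy i j
  have hsplitA : ∀ g : I → ℝ, ∑ i ∈ Finset.univ \ A, g i + ∑ i ∈ A, g i = ∑ i, g i := fun g =>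
    Finset.sum_sdiff (Finset.subset_univ A)
  -- light balls meeting a smaller heavy ball
  let Meets : I → I → Prop := fun l h => h ∈ H ∧ (∃ j, w₀ h j ≠ 0 ∧ x l j ≠ 0) ∧ r h ≤ r l
  let big := (Finset.univ \ A).filter fun l => ∃ h, Meets l h
  let small := (Finset.univ \ A).filter fun l => ¬ ∃ h, Meets l h
  have hsplit : ∀ g : I → ℝ, ∑ i ∈ big, g i + ∑ i ∈ small, g i = ∑ i ∈ Finset.univ \ A, g i :=
    fun g => Finset.sum_filter_add_sum_filter_not _ _ _
  have hkey : ∀ l, ∃ h, l ∈ big → Meets l h := fun l => by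
    by_cases hl : l ∈ big
    · obtain ⟨h, hh⟩ := (Finset.mem_filter.1 hl).2
      exact ⟨h, fun _ => hh⟩
    · exact ⟨l, fun h => absurd h hl⟩
  choose key hkey using hkey
  obtain ⟨s, hs, hsfib, hscard⟩ := exists_merging_of_key _ hD key y hy0 hy1 big
  have hkeycard : ((big.image key).card : ℝ) ≤ H.card := by
    exact_mod_cast Finset.card_le_card (Finset.image_subset_iff.2 fun l hl => (hkey l hl).1)
  let v : I → J → ℝ := fun k j => ∑ i ∈ big with s i = k, x i j
  have hvsum : ∀ j, ∑ k ∈ big.image s, v k j = ∑ i ∈ big, x i j := fun j =>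
    Finset.sum_fiberwise_of_maps_to (fun i hi => Finset.mem_image_of_mem s hi) _
  have hvload : ∀ k, ∑ j, v k j ≤ U k := fun k =>
    sum_merged_flow_le U x y hy0 hcap _ k (hsfib k) fun i hi => by
      obtain ⟨hib, rfl⟩ := Finset.mem_filter.1 hi
      exact (hs i hib).2.1.2
  have hvdist : ∀ k j, v k j ≠ 0 → dist (c k) (p j) ≤ 9 * r k := by
    intro k j hne
    obtain ⟨i, hi, hij⟩ := Finset.exists_ne_zero_of_sum_ne_zero hne
    obtain ⟨hib, rfl⟩ := Finset.mem_filter.1 hi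
    obtain ⟨hsb, ⟨hri, -⟩, hsk⟩ := hs i hib
    obtain ⟨-, ⟨a, haw, hax⟩, -⟩ := hkey i hib
    obtain ⟨-, ⟨b, hbw, hbx⟩, hrb⟩ := hkey (s i) hsb
    rw [hsk] at hbw hrb
    have t1 := dist_triangle4 (c (s i)) (p b) (c (key i)) (p j)
    have t2 := dist_triangle4 (c (key i)) (p a) (c i) (p j)
    rw [dist_comm (p b)] at t1
    rw [dist_comm (p a)] at t2
    linarith [hball _ _ hij, hball _ _ hax, hball _ _ hbx, hw₀dist _ _ haw, hw₀dist _ _ hbw]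
  -- the other light balls
  have hsmallA : Disjoint A small := by
    refine Finset.disjoint_left.2 fun i hi hi' => ?_
    exact (Finset.mem_sdiff.1 (Finset.mem_filter.1 hi').1).2 hi
  have hyu : ∀ i j, y i * (x i j / y i) = x i j := by
    intro i j
    rcases eq_or_ne (y i) 0 with h0 | h0
    · have := hxy i j
      rw [h0] at this
      rw [h0, zero_mul, le_antisymm this (hx0 i j)]
    · field_simp
  have hux : ∀ i j, x i j / y i ≠ 0 → x i j ≠ 0 := fun i j hne h0 => hne (by simp [h0])
  obtain ⟨O, hO, z, hz0, hzH, hzO, hzE, hzu, hzcov, hzcard⟩ :=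
    exists_light_rerouting H small (Finset.disjoint_of_subset_left hHA hsmallA)
      (fun i => (U i : ℝ)) y (fun i j => x i j / y i) w₀
      (fun k j => dist (c k) (p j) ≤ 9 * r k) hy0
      (fun i j => div_nonneg (hx0 i j) (hy0 i))
      (fun i j => div_le_one_of_le₀ (hxy i j) (hy0 i))
      (fun l hl j hne => by
        refine le_trans ?_ (hleft j)
        exact Finset.single_le_sum (f := y) (fun i _ => hy0 i)
          (Finset.mem_filter.2 ⟨(Finset.mem_filter.1 hl).1, hux l j hne⟩))
      hw₀
      (fun j => by
        rw [hw₀sum]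
        linarith [hrest j, hsplitA fun i => x i j, hflow j])
      (fun l _ => by
        rw [← Finset.sum_div]
        exact div_le_of_le_mul₀ (hy0 l) (Nat.cast_nonneg _) (by linarith [hcap l]))
      (fun h hh l hl j hwj huj j' huj' => by
        have hlt : r l < r h := not_le.1 fun hle =>
          (Finset.mem_filter.1 hl).2 ⟨h, hh, ⟨j, hwj, hux l j huj⟩, hle⟩
        have t1 := dist_triangle4 (c h) (p j) (c l) (p j')
        rw [dist_comm (p j)] at t1
        linarith [hball _ _ (hux l j huj), hball _ _ (hux l j' huj'), hw₀dist _ _ hwj, hr h])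
      small subset_rfl (fun _ => 1) w₀ (fun _ => 0) (fun _ => zero_le_one) (fun _ => le_rfl)
      (fun _ _ => le_rfl)
      (fun j => by
        simp only [hyu]
        rw [hw₀sum]
        have hbig0 : 0 ≤ ∑ i ∈ big, x i j := Finset.sum_nonneg fun i _ => hx0 i j
        linarith [hsplitA fun i => x i j, hsplit fun i => x i j, hflow j])
      (fun h hh => by simpa using hw₀load h hh) (fun _ _ => by norm_num)
      (fun h hh l _ => by simpa using hw₀load h hh)
      (fun h _ j hne => by linarith [hw₀dist h j hne, hr h])
  -- assembling the solution
  have hHO : Disjoint H O := Finset.disjoint_of_subset_left hHA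
    (Finset.disjoint_of_subset_right hO hsmallA)
  have hbigHO : ∀ k ∈ big.image s, k ∉ H ∪ O := by
    intro k hk hkHO
    obtain ⟨i, hi, rfl⟩ := Finset.mem_image.1 hk
    have hsb := Finset.mem_filter.1 (hs i hi).1
    rcases Finset.mem_union.1 hkHO with hkH | hkO
    · exact (Finset.mem_sdiff.1 hsb.1).2 (hHA hkH)
    · exact (Finset.mem_filter.1 (hO hkO)).2 hsb.2
  let Z : I → J → ℝ := fun k j => if k ∈ H ∪ O then z k j else v k j
  have hZin : ∀ k ∈ H ∪ O, Z k = z k := fun k hk => funext fun j => if_pos hk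
  have hZout : ∀ k ∉ H ∪ O, Z k = v k := fun k hk => funext fun j => if_neg hk
  obtain ⟨f, hfS, hfE, hfU⟩ := exists_assignment_of_fractional (H ∪ O ∪ big.image s) U
    (fun k j => dist (c k) (p j) ≤ 9 * r k) Z
    (fun k j => by
      by_cases hk : k ∈ H ∪ O
      · rw [hZin k hk]; exact hz0 k j
      · rw [hZout k hk]; exact Finset.sum_nonneg fun i _ => hx0 i j)
    (fun k _ j hne => by
      by_cases hk : k ∈ H ∪ O
      · rw [hZin k hk] at hne
        rcases Finset.mem_union.1 hk with hkH | hkO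
        · exact hzE k hkH j hne
        · linarith [hball _ _ (hux _ _ (hzu k hkO j hne)), hr k]
      · rw [hZout k hk] at hne
        exact hvdist k j hne)
    (fun k _ => by
      by_cases hk : k ∈ H ∪ O
      · rw [hZin k hk]
        exact (Finset.mem_union.1 hk).elim (hzH k) (hzO k)
      · rw [hZout k hk]; exact hvload k)
    (fun j => by
      rw [Finset.sum_union (Finset.disjoint_right.2 hbigHO),
        Finset.sum_congr rfl fun k hk => congrFun (hZin k hk) j,
        Finset.sum_congr rfl fun k hk => congrFun (hZout k (hbigHO k hk)) j,
        hvsum, Finset.sum_union hHO]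
      have := hzcov j
      simp only [hyu, one_mul] at this
      rw [hw₀sum] at this
      linarith [hsplitA fun i => x i j, hsplit fun i => x i j, hflow j])
  refine ⟨_, f, ?_, hfS, hfE, hfU⟩
  have hcard : ((H ∪ O ∪ big.image s).card : ℝ) ≤ H.card + O.card + (big.image s).card := by
    exact_mod_cast (Finset.card_union_le _ _).trans
      (Nat.add_le_add_right (Finset.card_union_le _ _) _)
  have hA0 : 0 ≤ ∑ i ∈ A, y i := Finset.sum_nonneg fun i _ => hy0 i
  have hb0 : 0 ≤ ∑ i ∈ big, y i := Finset.sum_nonneg fun i _ => hy0 i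
  have hs0 : 0 ≤ ∑ i ∈ small, y i := Finset.sum_nonneg fun i _ => hy0 i
  simp only [Finset.sum_const_zero, zero_add] at hzcard
  linarith [hsplitA y, hsplit y]
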